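/- Let D be a nonempty convex open set in ℝ^d, T > 0, and let {w_n}_{n≥1} be a sequence of right-continuous functions with left limits from [0,∞) to ℝ^d, each with w_n(0) ∈ D̄, such that for each n the Skorohod equation X_n = w_n + φ_n has a solution on [0,T]. Assume that w_n converges uniformly on [0,T] to a continuous function w with w(0) ∈ D̄, and that the total variations {|φ_n|(T)}_{n≥1} are bounded. Then X_n converges uniformly on [0,T] as n → ∞, and, setting X = lim X_n and φ = X − w, the pair (X, φ) is the solution of the Skorohod equation X = w + φ on [0,T]. -/

import Mathlib

open MeasureTheory Set Filter Topology
open scoped RealInnerProductSpace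

noncomputable section

abbrev Euc (d : ℕ) := EuclideanSpace ℝ (Fin d)

/-- Measure data representing the Lebesgue–Stieltjes measures `dφ` (componentwise, as a
difference of locally finite nonnegative measures) and `d|φ|` (the total variation measure)
of a function `φ : [0,∞) → ℝ^d` of locally bounded variation. -/
structure BVMeasureData (d : ℕ) (φ : ℝ → Euc d) where
  pos : Fin d → Measure ℝ
  neg : Fin d → Measure ℝ
  var : Measure ℝ
  pos_fin : ∀ i : Fin d, ∀ t : ℝ, pos i (Icc 0 t) < ⊤
  neg_fin : ∀ i : Fin d, ∀ t : ℝ, neg i (Icc 0 t) < ⊤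
  increments : ∀ i : Fin d, ∀ s t : ℝ, 0 ≤ s → s ≤ t →
    (pos i (Ioc s t)).toReal - (neg i (Ioc s t)).toReal = φ t i - φ s i
  var_eq : ∀ s t : ℝ, 0 ≤ s → s ≤ t → var (Ioc s t) = eVariationOn φ (Icc s t)

/-- The Stieltjes integral `∫_{(s,t]} ⟨f(τ), dφ(τ)⟩`. -/
def BVMeasureData.pairing {d : ℕ} {φ : ℝ → Euc d} (M : BVMeasureData d φ)
    (f : ℝ → Euc d) (s t : ℝ) : ℝ :=
  ∑ i : Fin d, ((∫ τ in Ioc s t, f τ i ∂(M.pos i)) - ∫ τ in Ioc s t, f τ i ∂(M.neg i))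

/-- `f` is right-continuous at every `t ≥ 0`. -/
def RightContinuousOnNonneg {E : Type*} [TopologicalSpace E] (f : ℝ → E) : Prop :=
  ∀ t : ℝ, 0 ≤ t → ContinuousWithinAt f (Ici t) t

/-- `f` has left limits at every `t > 0`. -/
def HasLeftLimitsOnPos {E : Type*} [TopologicalSpace E] (f : ℝ → E) : Prop :=
  ∀ t : ℝ, 0 < t → ∃ L, Tendsto f (𝓝[<] t) (𝓝 L)

/-- `φ` is associated with `X` (relative to the convex domain `D`):
`φ` is rcll of locally bounded variation with `φ(0) = 0`, the measure `d|φ|` does not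
charge `{t ≥ 0 : X(t) ∈ D}`, and `∫_{(s,t]} ⟨η(τ) − X(τ), dφ(τ)⟩ ≥ 0` for every
continuous `η : [0,∞) → closure D`. -/
structure IsAssociated {d : ℕ} (D : Set (Euc d)) (X : ℝ → Euc d) (φ : ℝ → Euc d)
    (M : BVMeasureData d φ) : Prop where
  rightCont : RightContinuousOnNonneg φ
  leftLim : HasLeftLimitsOnPos φ
  bv : ∀ t : ℝ, 0 ≤ t → eVariationOn φ (Icc 0 t) < ⊤
  init : φ 0 = 0
  carried : M.var {t : ℝ | 0 ≤ t ∧ X t ∈ D} = 0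
  normal : ∀ η : ℝ → Euc d, Continuous η → (∀ t : ℝ, 0 ≤ t → η t ∈ closure D) →
    ∀ s t : ℝ, 0 ≤ s → s ≤ t → 0 ≤ M.pairing (fun τ => η τ - X τ) s t

/-- `(X, φ)` (with measure data `M` for `φ`) solves the Skorohod equation `X = w + φ`
for the domain `D`. -/
structure IsSkorohodSolution {d : ℕ} (D : Set (Euc d)) (w X φ : ℝ → Euc d)
    (M : BVMeasureData d φ) : Prop where
  rightCont : RightContinuousOnNonneg X
  leftLim : HasLeftLimitsOnPos X
  mem : ∀ t : ℝ, 0 ≤ t → X t ∈ closure D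
  eqn : ∀ t : ℝ, 0 ≤ t → X t = w t + φ t
  assoc : IsAssociated D X φ M


/-- `(X, φ)` (with measure data `M` for `φ`) solves the Skorohod equation `X = w + φ`
for the domain `D` on the time interval `[0, T]`. -/
structure IsSkorohodSolutionOn {d : ℕ} (D : Set (Euc d)) (w X φ : ℝ → Euc d)
    (M : BVMeasureData d φ) (T : ℝ) : Prop where
  rightCont : ∀ t ∈ Ico (0 : ℝ) T, ContinuousWithinAt X (Ici t) t
  leftLim : ∀ t ∈ Ioc (0 : ℝ) T, ∃ L, Tendsto X (𝓝[<] t) (𝓝 L)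
  mem : ∀ t ∈ Icc (0 : ℝ) T, X t ∈ closure D
  eqn : ∀ t ∈ Icc (0 : ℝ) T, X t = w t + φ t
  phi_rightCont : ∀ t ∈ Ico (0 : ℝ) T, ContinuousWithinAt φ (Ici t) t
  phi_leftLim : ∀ t ∈ Ioc (0 : ℝ) T, ∃ L, Tendsto φ (𝓝[<] t) (𝓝 L)
  bv : eVariationOn φ (Icc 0 T) < ⊤
  init : φ 0 = 0
  carried : M.var {t : ℝ | t ∈ Icc (0 : ℝ) T ∧ X t ∈ D} = 0
  normal : ∀ η : ℝ → Euc d, Continuous η → (∀ t ∈ Icc (0 : ℝ) T, η t ∈ closure D) →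
    ∀ s t : ℝ, 0 ≤ s → s ≤ t → t ≤ T → 0 ≤ M.pairing (fun τ => η τ - X τ) s t

/-- Grid points. -/
def gp (s t : ℝ) (N k : ℕ) : ℝ := s + (t - s) * (k / (N + 1 : ℝ))

lemma gp_zero (s t : ℝ) (N : ℕ) : gp s t N 0 = s := by simp [gp]

lemma gp_last (s t : ℝ) (N : ℕ) : gp s t N (N + 1) = t := by
  have : (N + 1 : ℝ) ≠ 0 := by positivity
  simp [gp, div_self this]

lemma gp_mono {s t : ℝ} (hst : s ≤ t) (N : ℕ) : Monotone (gp s t N) := by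
  intro a b hab
  have h : (a : ℝ) ≤ b := by exact_mod_cast hab
  have := sub_nonneg.2 hst
  unfold gp
  gcongr

lemma gp_mem {s t : ℝ} (hst : s ≤ t) {N k : ℕ} (hk : k ≤ N + 1) : gp s t N k ∈ Icc s t := by
  constructor
  · have := gp_mono hst N (Nat.zero_le k); rwa [gp_zero] at this
  · have := gp_mono hst N hk; rwa [gp_last] at this

lemma gp_step (s t : ℝ) (N k : ℕ) :
    gp s t N (k + 1) = gp s t N k + (t - s) / (N + 1 : ℝ) := by
  unfold gp; push_cast; ring

/-- right endpoint -/
def rp (s t : ℝ) (N : ℕ) (τ : ℝ) : ℝ := gp s t N ⌈(τ - s) / (t - s) * (N + 1 : ℝ)⌉₊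

lemma rp_eq {s t : ℝ} {N k : ℕ} {τ : ℝ} (hst : s ≤ t)
    (h : τ ∈ Ioc (gp s t N k) (gp s t N (k + 1))) :
    rp s t N τ = gp s t N (k + 1) := by
  have hst' : s < t := by
    rcases hst.lt_or_eq with h' | h'
    · exact h'
    · subst h'; simp [gp] at h
  have hts : 0 < t - s := sub_pos.2 hst'
  have hN : (0 : ℝ) < N + 1 := by positivity
  obtain ⟨h1, h2⟩ := h
  have hd : (τ - s) / (t - s) * (N + 1 : ℝ) = (τ - s) * (N + 1) / (t - s) := by ring
  unfold rp
  congr 1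
  rw [Nat.ceil_eq_iff (by omega), hd]
  unfold gp at h1 h2
  constructor
  · rw [lt_div_iff₀ hts]
    have : (t - s) * (k / (N + 1 : ℝ)) < τ - s := by linarith
    rw [← mul_div_assoc, div_lt_iff₀ hN] at this
    simp; linarith
  · rw [div_le_iff₀ hts]
    have : τ - s ≤ (t - s) * ((k + 1 : ℕ) / (N + 1 : ℝ)) := by linarith
    rw [← mul_div_assoc, le_div_iff₀ hN] at this
    linarith

lemma exists_cell {s t : ℝ} (hst : s ≤ t) (N : ℕ) {τ : ℝ} (h : τ ∈ Ioc s t) :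
    ∃ k, k < N + 1 ∧ τ ∈ Ioc (gp s t N k) (gp s t N (k + 1)) := by
  classical
  have hex : ∃ k, τ ≤ gp s t N k := ⟨N + 1, by rw [gp_last]; exact h.2⟩
  have h0 : Nat.find hex ≠ 0 := by
    intro h0
    have := Nat.find_spec hex
    rw [h0, gp_zero] at this
    exact absurd h.1 (not_lt.2 this)
  obtain ⟨k, hk⟩ := Nat.exists_eq_succ_of_ne_zero h0
  refine ⟨k, ?_, ?_, ?_⟩
  · have : Nat.find hex ≤ N + 1 := Nat.find_min' hex (by rw [gp_last]; exact h.2)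
    omega
  · exact not_le.1 (Nat.find_min hex (m := k) (by omega))
  · have := Nat.find_spec hex
    rwa [hk] at this

lemma rp_bounds {s t : ℝ} (hst : s ≤ t) (N : ℕ) {τ : ℝ} (h : τ ∈ Ioc s t) :
    τ ≤ rp s t N τ ∧ rp s t N τ ≤ t ∧ rp s t N τ ≤ τ + (t - s) / (N + 1 : ℝ) := by
  obtain ⟨k, hk, hτ⟩ := exists_cell hst N h
  rw [rp_eq hst hτ]
  refine ⟨hτ.2, (gp_mem hst (by omega)).2, ?_⟩
  rw [gp_step]
  linarith [hτ.1]

lemma rp_tendsto {s t : ℝ} (hst : s ≤ t) {τ : ℝ} (h : τ ∈ Ioc s t) :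
    Tendsto (fun N => rp s t N τ) atTop (𝓝[Icc τ t] τ) := by
  rw [tendsto_nhdsWithin_iff]
  constructor
  · refine tendsto_of_tendsto_of_tendsto_of_le_of_le tendsto_const_nhds ?_
      (fun N => (rp_bounds hst N h).1) (fun N => (rp_bounds hst N h).2.2)
    have : Tendsto (fun N : ℕ => τ + (t - s) * (1 / ((N : ℝ) + 1))) atTop (𝓝 (τ + (t - s) * 0)) :=
      tendsto_const_nhds.add (tendsto_const_nhds.mul tendsto_one_div_add_atTop_nhds_zero_nat)
    simp only [mul_zero, add_zero, mul_one_div] at this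
    exact this
  · exact Eventually.of_forall fun N => ⟨(rp_bounds hst N h).1, (rp_bounds hst N h).2.1⟩

lemma rp_measurable (s t : ℝ) (N : ℕ) (g : ℝ → ℝ) : Measurable (fun τ => g (rp s t N τ)) := by
  have h1 : Measurable (fun τ : ℝ => ⌈(τ - s) / (t - s) * (N + 1 : ℝ)⌉₊) := by
    apply Nat.measurable_ceil.comp; fun_prop
  exact (measurable_from_nat (f := fun k => g (gp s t N k))).comp h1

/-- scalar Riemann sums -/
lemma scalar_riemann (μ : Measure ℝ) {s t : ℝ} (hst : s ≤ t) (hμ : μ (Ioc s t) < ⊤) (g : ℝ → ℝ)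
    (hg : ∀ τ ∈ Ioc s t, ContinuousWithinAt g (Icc τ t) τ) {B : ℝ}
    (hB : ∀ τ ∈ Icc s t, |g τ| ≤ B) :
    IntegrableOn g (Ioc s t) μ ∧
    Tendsto (fun N => ∑ k ∈ Finset.range (N + 1),
      g (gp s t N (k + 1)) * (μ (Ioc (gp s t N k) (gp s t N (k + 1)))).toReal) atTop
      (𝓝 (∫ τ in Ioc s t, g τ ∂μ)) := by
  have : IsFiniteMeasure (μ.restrict (Ioc s t)) := ⟨by simpa using hμ⟩
  have hlim : ∀ᵐ τ ∂(μ.restrict (Ioc s t)),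
      Tendsto (fun N => g (rp s t N τ)) atTop (𝓝 (g τ)) := by
    filter_upwards [ae_restrict_mem measurableSet_Ioc] with τ hτ
    exact (hg τ hτ).tendsto.comp (rp_tendsto hst hτ)
  have hmem : ∀ N, ∀ τ ∈ Ioc s t, rp s t N τ ∈ Icc s t := fun N τ hτ =>
    ⟨hτ.1.le.trans (rp_bounds hst N hτ).1, (rp_bounds hst N hτ).2.1⟩
  have hbd : ∀ N, ∀ᵐ τ ∂(μ.restrict (Ioc s t)), ‖g (rp s t N τ)‖ ≤ B := by
    intro N
    filter_upwards [ae_restrict_mem measurableSet_Ioc] with τ hτ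
    exact hB _ (hmem N τ hτ)
  have hmeas : AEStronglyMeasurable g (μ.restrict (Ioc s t)) :=
    aestronglyMeasurable_of_tendsto_ae atTop
      (fun N => (rp_measurable s t N g).aestronglyMeasurable) hlim
  have hint : IntegrableOn g (Ioc s t) μ := by
    refine Integrable.of_bound hmeas B ?_
    filter_upwards [ae_restrict_mem measurableSet_Ioc] with τ hτ
    exact hB _ ⟨hτ.1.le, hτ.2⟩
  refine ⟨hint, ?_⟩
  have hconv := tendsto_integral_of_dominated_convergence (fun _ => B)
    (fun N => (rp_measurable s t N g).aestronglyMeasurable) (integrable_const B) hbd hlim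
  refine hconv.congr fun N => ?_
  have hintN : IntegrableOn (fun τ => g (rp s t N τ)) (Ioc s t) μ :=
    Integrable.of_bound (rp_measurable s t N g).aestronglyMeasurable B (hbd N)
  have hsub : ∀ k < N + 1, Ioc (gp s t N k) (gp s t N (k + 1)) ⊆ Ioc s t := fun k hk =>
    Ioc_subset_Ioc (gp_mem hst (by omega)).1 (gp_mem hst (by omega)).2
  have hadj := intervalIntegral.sum_integral_adjacent_intervals (μ := μ)
    (f := fun τ => g (rp s t N τ)) (a := gp s t N) (n := N + 1) (fun k hk => by
      rw [intervalIntegrable_iff_integrableOn_Ioc_of_le (gp_mono hst N (Nat.le_succ k))]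
      exact hintN.mono_set (hsub k hk))
  rw [gp_zero, gp_last, intervalIntegral.integral_of_le hst] at hadj
  rw [← hadj]
  refine Finset.sum_congr rfl fun k hk => ?_
  rw [intervalIntegral.integral_of_le (gp_mono hst N (Nat.le_succ k)),
    setIntegral_congr_fun measurableSet_Ioc (g := fun _ => g (gp s t N (k + 1)))
      (fun τ hτ => by simp only [rp_eq hst hτ])]
  rw [setIntegral_const, smul_eq_mul, mul_comm]
  rfl

/-- Bounded functions which are right-continuous (inside `[s,t]`). -/
structure Reg {d : ℕ} (f : ℝ → Euc d) (s t : ℝ) : Prop where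
  rc : ∀ τ ∈ Icc s t, ContinuousWithinAt f (Icc τ t) τ
  bd : ∃ B : ℝ, ∀ τ ∈ Icc s t, ‖f τ‖ ≤ B

lemma Reg.mono {d : ℕ} {f : ℝ → Euc d} {s t a b : ℝ} (h : Reg f s t) (hs : s ≤ a) (ht : b ≤ t) :
    Reg f a b where
  rc τ hτ := (h.rc τ ⟨hs.trans hτ.1, hτ.2.trans ht⟩).mono (Icc_subset_Icc le_rfl ht)
  bd := by
    obtain ⟨B, hB⟩ := h.bd
    exact ⟨B, fun τ hτ => hB τ ⟨hs.trans hτ.1, hτ.2.trans ht⟩⟩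

lemma Reg.sub {d : ℕ} {f g : ℝ → Euc d} {s t : ℝ} (hf : Reg f s t) (hg : Reg g s t) :
    Reg (fun τ => f τ - g τ) s t where
  rc τ hτ := (hf.rc τ hτ).sub (hg.rc τ hτ)
  bd := by
    obtain ⟨B, hB⟩ := hf.bd
    obtain ⟨B', hB'⟩ := hg.bd
    exact ⟨B + B', fun τ hτ => (norm_sub_le _ _).trans (add_le_add (hB τ hτ) (hB' τ hτ))⟩

lemma Reg.const {d : ℕ} (z : Euc d) (s t : ℝ) : Reg (fun _ => z) s t where
  rc _ _ := continuousWithinAt_const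
  bd := ⟨‖z‖, fun _ _ => le_rfl⟩

lemma Reg.of_continuousOn {d : ℕ} {f : ℝ → Euc d} {s t : ℝ} (hf : ContinuousOn f (Icc s t)) :
    Reg f s t where
  rc τ hτ := (hf τ hτ).mono (Icc_subset_Icc hτ.1 le_rfl)
  bd := isCompact_Icc.exists_bound_of_continuousOn hf

/-- Riemann sums. -/
def RS {d : ℕ} (f φ : ℝ → Euc d) (s t : ℝ) (N : ℕ) : ℝ :=
  ∑ k ∈ Finset.range (N + 1),
    ⟪f (gp s t N (k + 1)), φ (gp s t N (k + 1)) - φ (gp s t N k)⟫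

lemma inner_euc {d : ℕ} (x y : Euc d) : ⟪x, y⟫ = ∑ i, x i * y i := by
  rw [PiLp.inner_apply]
  refine Finset.sum_congr rfl fun i _ => ?_
  simp [mul_comm]

section
variable {d : ℕ} {φ : ℝ → Euc d} (M : BVMeasureData d φ)

lemma pos_lt {s t : ℝ} (hs : 0 ≤ s) (i : Fin d) : M.pos i (Ioc s t) < ⊤ :=
  (measure_mono (show Ioc s t ⊆ Icc 0 t from fun _ hx => ⟨hs.trans hx.1.le, hx.2⟩)).trans_lt (M.pos_fin i t)

lemma neg_lt' {s t : ℝ} (hs : 0 ≤ s) (i : Fin d) : M.neg i (Ioc s t) < ⊤ :=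
  (measure_mono (show Ioc s t ⊆ Icc 0 t from fun _ hx => ⟨hs.trans hx.1.le, hx.2⟩)).trans_lt (M.neg_fin i t)

lemma reg_scalar {f : ℝ → Euc d} {s t : ℝ} (hf : Reg f s t) (i : Fin d) :
    (∀ τ ∈ Ioc s t, ContinuousWithinAt (fun τ => f τ i) (Icc τ t) τ) ∧
      ∃ B : ℝ, ∀ τ ∈ Icc s t, |f τ i| ≤ B := by
  obtain ⟨B, hB⟩ := hf.bd
  refine ⟨fun τ hτ => ?_, B, fun τ hτ => ?_⟩
  · have := hf.rc τ ⟨hτ.1.le, hτ.2⟩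
    have hc : Continuous (fun x : Euc d => x i) := by fun_prop
    exact hc.continuousAt.comp_continuousWithinAt this
  · exact (PiLp.norm_apply_le (f τ) i).trans (hB τ hτ)

lemma reg_int_pos {f : ℝ → Euc d} {s t : ℝ} (hs : 0 ≤ s) (hst : s ≤ t) (hf : Reg f s t)
    (i : Fin d) : IntegrableOn (fun τ => f τ i) (Ioc s t) (M.pos i) := by
  obtain ⟨h1, B, h2⟩ := reg_scalar hf i
  exact (scalar_riemann _ hst (pos_lt M hs i) _ h1 h2).1

lemma reg_int_neg {f : ℝ → Euc d} {s t : ℝ} (hs : 0 ≤ s) (hst : s ≤ t) (hf : Reg f s t)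
    (i : Fin d) : IntegrableOn (fun τ => f τ i) (Ioc s t) (M.neg i) := by
  obtain ⟨h1, B, h2⟩ := reg_scalar hf i
  exact (scalar_riemann _ hst (neg_lt' M hs i) _ h1 h2).1

lemma RS_tendsto {f : ℝ → Euc d} {s t : ℝ} (hs : 0 ≤ s) (hst : s ≤ t) (hf : Reg f s t) :
    Tendsto (RS f φ s t) atTop (𝓝 (M.pairing f s t)) := by
  have key : Tendsto (fun N => ∑ i : Fin d,
      ((∑ k ∈ Finset.range (N + 1), f (gp s t N (k + 1)) i *
        (M.pos i (Ioc (gp s t N k) (gp s t N (k + 1)))).toReal) -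
      (∑ k ∈ Finset.range (N + 1), f (gp s t N (k + 1)) i *
        (M.neg i (Ioc (gp s t N k) (gp s t N (k + 1)))).toReal))) atTop
      (𝓝 (M.pairing f s t)) := by
    refine tendsto_finsetSum _ fun i _ => ?_
    obtain ⟨h1, B, h2⟩ := reg_scalar hf i
    exact (scalar_riemann _ hst (pos_lt M hs i) _ h1 h2).2.sub
      (scalar_riemann _ hst (neg_lt' M hs i) _ h1 h2).2
  refine key.congr fun N => ?_
  unfold RS
  simp_rw [inner_euc]
  rw [Finset.sum_comm]
  refine Finset.sum_congr rfl fun i _ => ?_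
  rw [← Finset.sum_sub_distrib]
  refine Finset.sum_congr rfl fun k hk => ?_
  have hk' : k < N + 1 := Finset.mem_range.1 hk
  rw [← mul_sub, M.increments i _ _ (hs.trans (gp_mem hst (by omega)).1)
    (gp_mono hst N (Nat.le_succ k))]
  simp

lemma pairing_sub {f g : ℝ → Euc d} {s t : ℝ} (hs : 0 ≤ s) (hst : s ≤ t) (hf : Reg f s t)
    (hg : Reg g s t) :
    M.pairing (fun τ => f τ - g τ) s t = M.pairing f s t - M.pairing g s t := by
  unfold BVMeasureData.pairing
  rw [← Finset.sum_sub_distrib]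
  refine Finset.sum_congr rfl fun i _ => ?_
  simp only [PiLp.sub_apply]
  rw [integral_sub (reg_int_pos M hs hst hf i) (reg_int_pos M hs hst hg i),
    integral_sub (reg_int_neg M hs hst hf i) (reg_int_neg M hs hst hg i)]
  ring

lemma pairing_const (z : Euc d) {s t : ℝ} (hs : 0 ≤ s) (hst : s ≤ t) :
    M.pairing (fun _ => z) s t = ⟪z, φ t - φ s⟫ := by
  unfold BVMeasureData.pairing
  rw [inner_euc]
  refine Finset.sum_congr rfl fun i _ => ?_
  rw [setIntegral_const, setIntegral_const, PiLp.sub_apply, ← M.increments i s t hs hst]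
  simp only [smul_eq_mul, Measure.real]
  ring

lemma pairing_adj {f : ℝ → Euc d} {s t : ℝ} (hs : 0 ≤ s) (hst : s ≤ t) (hf : Reg f s t) (N : ℕ) :
    ∑ k ∈ Finset.range (N + 1), M.pairing f (gp s t N k) (gp s t N (k + 1)) =
      M.pairing f s t := by
  unfold BVMeasureData.pairing
  rw [Finset.sum_comm]
  refine Finset.sum_congr rfl fun i _ => ?_
  rw [Finset.sum_sub_distrib]
  have hsub : ∀ k < N + 1, Ioc (gp s t N k) (gp s t N (k + 1)) ⊆ Ioc s t := fun k hk =>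
    Ioc_subset_Ioc (gp_mem hst (by omega)).1 (gp_mem hst (by omega)).2
  have main : ∀ μ : Measure ℝ, IntegrableOn (fun τ => f τ i) (Ioc s t) μ →
      ∑ k ∈ Finset.range (N + 1), ∫ τ in Ioc (gp s t N k) (gp s t N (k + 1)), f τ i ∂μ =
        ∫ τ in Ioc s t, f τ i ∂μ := by
    intro μ hμ
    have hadj := intervalIntegral.sum_integral_adjacent_intervals (μ := μ)
      (f := fun τ => f τ i) (a := gp s t N) (n := N + 1) (fun k hk => by
        rw [intervalIntegrable_iff_integrableOn_Ioc_of_le (gp_mono hst N (Nat.le_succ k))]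
        exact hμ.mono_set (hsub k hk))
    rw [gp_zero, gp_last, intervalIntegral.integral_of_le hst] at hadj
    rw [← hadj]
    refine Finset.sum_congr rfl fun k hk => ?_
    rw [intervalIntegral.integral_of_le (gp_mono hst N (Nat.le_succ k))]
  rw [main _ (reg_int_pos M hs hst hf i), main _ (reg_int_neg M hs hst hf i)]

end

lemma sum_norm_le {d : ℕ} {φ : ℝ → Euc d} {s t : ℝ} (hst : s ≤ t) {C : ℝ} (hC : 0 ≤ C)
    (hφ : eVariationOn φ (Icc s t) ≤ ENNReal.ofReal C) (N : ℕ) :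
    ∑ k ∈ Finset.range (N + 1), ‖φ (gp s t N (k + 1)) - φ (gp s t N k)‖ ≤ C := by
  have h := eVariationOn.sum_le_of_monotoneOn_Iic (f := φ) (s := Icc s t) (n := N + 1)
    (u := gp s t N) ((gp_mono hst N).monotoneOn _) (fun i hi => gp_mem hst hi)
  have h2 := h.trans hφ
  simp_rw [edist_dist, dist_eq_norm] at h2
  rw [← ENNReal.ofReal_sum_of_nonneg (fun _ _ => norm_nonneg _)] at h2
  exact (ENNReal.ofReal_le_ofReal_iff hC).1 h2

lemma RS_le {d : ℕ} {f φ : ℝ → Euc d} {s t : ℝ} (hst : s ≤ t) {C B : ℝ} (hC : 0 ≤ C) (hB0 : 0 ≤ B)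
    (hφ : eVariationOn φ (Icc s t) ≤ ENNReal.ofReal C) (hB : ∀ τ ∈ Icc s t, ‖f τ‖ ≤ B) (N : ℕ) :
    |RS f φ s t N| ≤ B * C := by
  unfold RS
  calc _ ≤ ∑ k ∈ Finset.range (N + 1),
        |⟪f (gp s t N (k + 1)), φ (gp s t N (k + 1)) - φ (gp s t N k)⟫| :=
        Finset.abs_sum_le_sum_abs _ _
    _ ≤ ∑ k ∈ Finset.range (N + 1), B * ‖φ (gp s t N (k + 1)) - φ (gp s t N k)‖ := by
        refine Finset.sum_le_sum fun k hk => ?_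
        have hk' : k < N + 1 := Finset.mem_range.1 hk
        exact (abs_real_inner_le_norm _ _).trans
          (mul_le_mul_of_nonneg_right (hB _ (gp_mem hst (by omega))) (norm_nonneg _))
    _ ≤ B * C := by
        rw [← Finset.mul_sum]
        exact mul_le_mul_of_nonneg_left (sum_norm_le hst hC hφ N) hB0

lemma pairing_le {d : ℕ} {f φ : ℝ → Euc d} (M : BVMeasureData d φ) {s t : ℝ} (hs : 0 ≤ s)
    (hst : s ≤ t) (hf : Reg f s t) {C B : ℝ} (hC : 0 ≤ C) (hB0 : 0 ≤ B)
    (hφ : eVariationOn φ (Icc s t) ≤ ENNReal.ofReal C) (hB : ∀ τ ∈ Icc s t, ‖f τ‖ ≤ B) :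
    |M.pairing f s t| ≤ B * C :=
  le_of_tendsto (RS_tendsto M hs hst hf).abs
    (Eventually.of_forall fun N => RS_le hst hC hB0 hφ hB N)

lemma RS_self {d : ℕ} (ψ : ℝ → Euc d) (s t : ℝ) (N : ℕ) :
    ‖ψ t‖ ^ 2 - ‖ψ s‖ ^ 2 ≤ 2 * RS ψ ψ s t N := by
  have h := Finset.sum_range_sub (fun k => ‖ψ (gp s t N k)‖ ^ 2) (N + 1)
  rw [gp_zero, gp_last] at h
  rw [← h, RS, Finset.mul_sum]
  refine Finset.sum_le_sum fun k _ => ?_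
  set b := ψ (gp s t N (k + 1))
  set a := ψ (gp s t N k)
  have h1 := norm_sub_sq_real b a
  have h2 : ⟪b, b - a⟫ = ‖b‖ ^ 2 - ⟪b, a⟫ := by
    rw [inner_sub_right, real_inner_self_eq_norm_sq]
  nlinarith [sq_nonneg ‖b - a‖]

lemma RS_sub_left {d : ℕ} (f g φ : ℝ → Euc d) (s t : ℝ) (N : ℕ) :
    RS (fun τ => f τ - g τ) φ s t N = RS f φ s t N - RS g φ s t N := by
  simp only [RS, ← Finset.sum_sub_distrib, inner_sub_left]

lemma RS_sub_right {d : ℕ} (f φ χ : ℝ → Euc d) (s t : ℝ) (N : ℕ) :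
    RS f (fun τ => φ τ - χ τ) s t N = RS f φ s t N - RS f χ s t N := by
  simp only [RS, ← Finset.sum_sub_distrib, ← inner_sub_right]
  refine Finset.sum_congr rfl fun k _ => ?_
  congr 1
  abel

lemma RS_congr_left {d : ℕ} {f g : ℝ → Euc d} (φ : ℝ → Euc d) {s t : ℝ} (hst : s ≤ t) (N : ℕ)
    (h : ∀ τ ∈ Icc s t, f τ = g τ) : RS f φ s t N = RS g φ s t N := by
  unfold RS
  refine Finset.sum_congr rfl fun k hk => ?_
  have hk' : k < N + 1 := Finset.mem_range.1 hk
  rw [h _ (gp_mem hst (by omega))]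

/-- Comparison of the integral with Riemann sums for functions of small oscillation. -/
lemma pairing_RS {d : ℕ} {f φ : ℝ → Euc d} (M : BVMeasureData d φ) {s t : ℝ} (hs : 0 ≤ s)
    (hst : s ≤ t) (hf : Reg f s t) {C ω : ℝ} (hC : 0 ≤ C) (hω : 0 ≤ ω)
    (hφ : eVariationOn φ (Icc s t) ≤ ENNReal.ofReal C) (N : ℕ)
    (hosc : ∀ k < N + 1, ∀ τ ∈ Icc (gp s t N k) (gp s t N (k + 1)),
      ‖f τ - f (gp s t N (k + 1))‖ ≤ ω) :
    |M.pairing f s t - RS f φ s t N| ≤ ω * C := by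
  have hlt : eVariationOn φ (Icc s t) ≠ ⊤ := (hφ.trans_lt ENNReal.ofReal_lt_top).ne
  have hsub : ∀ k < N + 1, Icc (gp s t N k) (gp s t N (k + 1)) ⊆ Icc s t := fun k hk =>
    Icc_subset_Icc (gp_mem hst (by omega)).1 (gp_mem hst (by omega)).2
  have hvk : ∀ k < N + 1, eVariationOn φ (Icc (gp s t N k) (gp s t N (k + 1))) ≠ ⊤ :=
    fun k hk => ((eVariationOn.mono φ (hsub k hk)).trans_lt hlt.lt_top).ne
  have hsum : ∑ k ∈ Finset.range (N + 1),
      (eVariationOn φ (Icc (gp s t N k) (gp s t N (k + 1)))).toReal ≤ C := by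
    rw [← ENNReal.toReal_sum (fun k hk => hvk k (Finset.mem_range.1 hk)),
      eVariationOn.sum' φ (gp_mono hst N), gp_zero, gp_last]
    exact ENNReal.toReal_le_of_le_ofReal hC hφ
  rw [← pairing_adj M hs hst hf N, RS, ← Finset.sum_sub_distrib]
  refine (Finset.abs_sum_le_sum_abs _ _).trans ?_
  refine le_trans ?_ (mul_le_mul_of_nonneg_left hsum hω)
  rw [Finset.mul_sum]
  refine Finset.sum_le_sum fun k hk => ?_
  have hk' : k < N + 1 := Finset.mem_range.1 hk
  have h0 : 0 ≤ gp s t N k := hs.trans (gp_mem hst (by omega)).1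
  have hm := gp_mono hst N (Nat.le_succ k)
  have hr : Reg f (gp s t N k) (gp s t N (k + 1)) :=
    hf.mono (gp_mem hst (by omega)).1 (gp_mem hst (by omega)).2
  rw [← pairing_const M _ h0 hm, ← pairing_sub M h0 hm hr (Reg.const _ _ _)]
  refine pairing_le M h0 hm (hr.sub (Reg.const _ _ _)) ENNReal.toReal_nonneg hω ?_ (hosc k hk')
  rw [ENNReal.ofReal_toReal (hvk k hk')]

lemma bounded_of_cadlag {d : ℕ} {X : ℝ → Euc d} {T : ℝ}
    (hr : ∀ t ∈ Ico (0 : ℝ) T, ContinuousWithinAt X (Ici t) t)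
    (hl : ∀ t ∈ Ioc (0 : ℝ) T, ∃ L, Tendsto X (𝓝[<] t) (𝓝 L)) : Reg X 0 T where
  rc τ hτ := by
    rcases hτ.2.lt_or_eq with h | h
    · exact (hr τ ⟨hτ.1, h⟩).mono Icc_subset_Ici_self
    · subst h; simp
  bd := by
    have := isCompact_Icc.induction_on (s := Icc (0 : ℝ) T)
      (p := fun S => ∃ B : ℝ, ∀ τ ∈ S, τ ∈ Icc (0 : ℝ) T → ‖X τ‖ ≤ B) ⟨0, by simp⟩
      (fun S S' h ⟨B, hB⟩ => ⟨B, fun τ hτ => hB τ (h hτ)⟩)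
      (fun S S' ⟨B, hB⟩ ⟨B', hB'⟩ => ⟨max B B', fun τ hτ hT => by
        rcases hτ with h | h
        · exact (hB τ h hT).trans (le_max_left _ _)
        · exact (hB' τ h hT).trans (le_max_right _ _)⟩) ?_
    · obtain ⟨B, hB⟩ := this
      exact ⟨B, fun τ hτ => hB τ hτ hτ⟩
    intro x hx
    have hleft : ∃ B : ℝ, ∀ᶠ τ in 𝓝[<] x, τ ∈ Icc (0 : ℝ) T → ‖X τ‖ ≤ B := by
      rcases hx.1.lt_or_eq with h | h
      · obtain ⟨L, hL⟩ := hl x ⟨h, hx.2⟩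
        refine ⟨‖L‖ + 1, ?_⟩
        filter_upwards [hL.norm.eventually_lt_const (lt_add_one _)] with τ h _ using h.le
      · refine ⟨0, ?_⟩
        filter_upwards [self_mem_nhdsWithin] with τ h1 h2
        subst h
        exact absurd h1 (not_lt.2 h2.1)
    have hright : ∃ B : ℝ, ∀ᶠ τ in 𝓝[≥] x, τ ∈ Icc (0 : ℝ) T → ‖X τ‖ ≤ B := by
      rcases hx.2.lt_or_eq with h | h
      · refine ⟨‖X x‖ + 1, ?_⟩
        filter_upwards [(hr x ⟨hx.1, h⟩).tendsto.norm.eventually_lt_const (lt_add_one _)]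
          with τ h _ using h.le
      · refine ⟨‖X x‖, ?_⟩
        filter_upwards [self_mem_nhdsWithin] with τ h1 h2
        have : τ = x := le_antisymm (h ▸ h2.2) h1
        rw [this]
    obtain ⟨B, hB⟩ := hleft
    obtain ⟨B', hB'⟩ := hright
    refine ⟨{τ | τ ∈ Icc (0 : ℝ) T → ‖X τ‖ ≤ max B B'}, ?_, max B B', fun τ h => h⟩
    refine mem_nhdsWithin_of_mem_nhds ?_
    rw [← nhdsLT_sup_nhdsGE]
    refine mem_sup.2 ⟨?_, ?_⟩
    · filter_upwards [hB] with τ h h' using (h h').trans (le_max_left _ _)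
    · filter_upwards [hB'] with τ h h' using (h h').trans (le_max_right _ _)

section
variable {d : ℕ} {D : Set (Euc d)} {w X φ : ℝ → Euc d} {M : BVMeasureData d φ} {T : ℝ}

lemma sol_regX (h : IsSkorohodSolutionOn D w X φ M T) : Reg X 0 T :=
  bounded_of_cadlag h.rightCont h.leftLim

/-- The variational inequality for right-continuous test functions. -/
lemma normal_rc (h : IsSkorohodSolutionOn D w X φ M T) {s t : ℝ} (hs : 0 ≤ s) (hst : s ≤ t)
    (htT : t ≤ T) {η : ℝ → Euc d} (hη : Reg η s t) (hmem : ∀ τ ∈ Icc s t, η τ ∈ closure D) :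
    0 ≤ M.pairing (fun τ => η τ - X τ) s t := by
  have hX : Reg X s t := (sol_regX h).mono hs htT
  rw [pairing_sub M hs hst hη hX, sub_nonneg]
  refine ge_of_tendsto (RS_tendsto M hs hst hη) (Eventually.of_forall fun N => ?_)
  rw [← pairing_adj M hs hst hX N, RS]
  refine Finset.sum_le_sum fun k hk => ?_
  have hk' : k < N + 1 := Finset.mem_range.1 hk
  have hl := gp_mem hst (N := N) (k := k) (by omega)
  have hr := gp_mem hst (N := N) (k := k + 1) (by omega)
  have h0 : 0 ≤ gp s t N k := hs.trans hl.1
  have hm := gp_mono hst N (Nat.le_succ k)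
  have := h.normal (fun _ => η (gp s t N (k + 1))) continuous_const
    (fun _ _ => hmem _ hr) _ _ h0 hm (hr.2.trans htT)
  rw [pairing_sub M h0 hm (Reg.const _ _ _) (hX.mono hl.1 hr.2), pairing_const M _ h0 hm] at this
  linarith

lemma increment_bound (h : IsSkorohodSolutionOn D w X φ M T) {C δ : ℝ} (hC : 0 ≤ C) (hδ : 0 ≤ δ)
    (hφ : eVariationOn φ (Icc 0 T) ≤ ENNReal.ofReal C) {s t : ℝ} (hs : 0 ≤ s) (hst : s ≤ t)
    (htT : t ≤ T) (hw : ∀ u ∈ Icc s t, ‖w u - w s‖ ≤ δ) :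
    ‖φ t - φ s‖ ^ 2 ≤ 2 * (δ * C) := by
  have hX : Reg X s t := (sol_regX h).mono hs htT
  have hR := hX.sub (Reg.const (X s) s t)
  have hc : Reg (fun _ => X s) s t := Reg.const (X s) s t
  have hφ' : eVariationOn φ (Icc s t) ≤ ENNReal.ofReal C :=
    (eVariationOn.mono φ (Icc_subset_Icc hs htT)).trans hφ
  have h1 := normal_rc h hs hst htT hc (fun τ _ => h.mem s ⟨hs, hst.trans htT⟩)
  have hlim := RS_tendsto M hs hst (hc.sub hX)
  have hb : ∀ N, ‖φ t - φ s‖ ^ 2 ≤ -2 * RS (fun τ => X s - X τ) φ s t N + 2 * (δ * C) := by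
    intro N
    have h2 := RS_self (fun τ => φ τ - φ s) s t N
    have h3 := RS_le hst hC hδ hφ' hw N
    have h4 : RS (fun τ => φ τ - φ s) (fun τ => φ τ - φ s) s t N
        = RS (fun τ => φ τ - φ s) φ s t N := by
      rw [RS_sub_right _ φ (fun _ => φ s)]
      simp [RS]
    have h5 : RS (fun τ => φ τ - φ s) φ s t N
        = - RS (fun τ => X s - X τ) φ s t N - RS (fun τ => w τ - w s) φ s t N := by
      have : RS (fun τ => φ τ - φ s) φ s t N =
          RS (fun τ => (X τ - X s) - (w τ - w s)) φ s t N := by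
        refine RS_congr_left φ hst N fun τ hτ => ?_
        rw [h.eqn τ ⟨hs.trans hτ.1, hτ.2.trans htT⟩, h.eqn s ⟨hs, hst.trans htT⟩]
        abel
      rw [this, RS_sub_left (fun τ => X τ - X s), RS_sub_left X, RS_sub_left (fun _ => X s)]
      ring
    simp only [sub_self, norm_zero] at h2
    have := abs_le.1 h3
    linarith [this.1]
  have h6 := ge_of_tendsto ((hlim.const_mul (-2)).add_const (2 * (δ * C)))
    (Eventually.of_forall hb)
  linarith

lemma compare_bound {w' X' φ' : ℝ → Euc d} {M' : BVMeasureData d φ'}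
    (h : IsSkorohodSolutionOn D w X φ M T) (h' : IsSkorohodSolutionOn D w' X' φ' M' T)
    {C δ : ℝ} (hC : 0 ≤ C) (hδ : 0 ≤ δ)
    (hφ : eVariationOn φ (Icc 0 T) ≤ ENNReal.ofReal C)
    (hφ' : eVariationOn φ' (Icc 0 T) ≤ ENNReal.ofReal C)
    (hw : ∀ u ∈ Icc (0 : ℝ) T, ‖w u - w' u‖ ≤ δ) {t : ℝ} (ht : t ∈ Icc (0 : ℝ) T) :
    ‖φ t - φ' t‖ ^ 2 ≤ 4 * (δ * C) := by
  have hX : Reg X 0 t := (sol_regX h).mono le_rfl ht.2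
  have hX' : Reg X' 0 t := (sol_regX h').mono le_rfl ht.2
  have hsub : Icc 0 t ⊆ Icc 0 T := Icc_subset_Icc le_rfl ht.2
  have v := (eVariationOn.mono φ hsub).trans hφ
  have v' := (eVariationOn.mono φ' hsub).trans hφ'
  have h1 := normal_rc h le_rfl ht.1 ht.2 hX' (fun τ hτ => h'.mem τ (hsub hτ))
  have h1' := normal_rc h' le_rfl ht.1 ht.2 hX (fun τ hτ => h.mem τ (hsub hτ))
  have hlim := RS_tendsto M le_rfl ht.1 (hX'.sub hX)
  have hlim' := RS_tendsto M' le_rfl ht.1 (hX.sub hX')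
  have hb : ∀ N, ‖φ t - φ' t‖ ^ 2 ≤
      -2 * (RS (fun τ => X' τ - X τ) φ 0 t N + RS (fun τ => X τ - X' τ) φ' 0 t N)
        + 4 * (δ * C) := by
    intro N
    have h2 := RS_self (fun τ => φ τ - φ' τ) 0 t N
    have h3 := RS_le ht.1 hC hδ v (fun τ hτ => hw τ (hsub hτ)) N
    have h3' := RS_le ht.1 hC hδ v' (fun τ hτ => hw τ (hsub hτ)) N
    have h5 : ∀ χ : ℝ → Euc d, RS (fun τ => φ τ - φ' τ) χ 0 t N
        = RS X χ 0 t N - RS X' χ 0 t N - RS (fun τ => w τ - w' τ) χ 0 t N := by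
      intro χ
      have : RS (fun τ => φ τ - φ' τ) χ 0 t N =
          RS (fun τ => (X τ - X' τ) - (w τ - w' τ)) χ 0 t N := by
        refine RS_congr_left χ ht.1 N fun τ hτ => ?_
        rw [h.eqn τ (hsub hτ), h'.eqn τ (hsub hτ)]
        abel
      rw [this, RS_sub_left (fun τ => X τ - X' τ), RS_sub_left X]
    rw [RS_sub_right, h5, h5] at h2
    rw [RS_sub_left X' X, RS_sub_left X X']
    simp only [h.init, h'.init, sub_self, norm_zero] at h2
    linarith [(abs_le.1 h3).1, (abs_le.1 h3').2]
  have h6 := ge_of_tendsto (((hlim.add hlim').const_mul (-2)).add_const (4 * (δ * C)))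
    (Eventually.of_forall hb)
  linarith

end

/-- Measure data for a continuous function of bounded variation. -/
def mkData {d : ℕ} (φ : ℝ → Euc d) (hc : Continuous φ) (hbv : BoundedVariationOn φ univ) :
    BVMeasureData d φ :=
  let V : StieltjesFunction ℝ :=
    { toFun := variationOnFromTo φ univ 0
      mono' := fun a b hab => variationOnFromTo.monotoneOn hbv.locallyBoundedVariationOn
        (mem_univ 0) (mem_univ a) (mem_univ b) hab
      right_continuous' := fun x => hbv.continuousWithinAt_variationOnFromTo_Ici
        hc.continuousWithinAt }
  have hV : ∀ a b, a ≤ b → V b - V a = (eVariationOn φ (Icc a b)).toReal := fun a b hab => by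
    have h1 := variationOnFromTo.add hbv.locallyBoundedVariationOn
      (mem_univ (0 : ℝ)) (mem_univ a) (mem_univ b)
    have h2 := variationOnFromTo.eq_of_le φ univ hab
    rw [univ_inter] at h2
    change variationOnFromTo φ univ 0 b - variationOnFromTo φ univ 0 a = _
    linarith
  have hfin : ∀ a b, eVariationOn φ (Icc a b) ≠ ⊤ := fun a b =>
    ((eVariationOn.mono φ (subset_univ _)).trans_lt hbv.lt_top).ne
  have hW : ∀ i : Fin d, ∀ a b, a ≤ b → φ b i - φ a i ≤ V b - V a := fun i a b hab => by
    rw [hV a b hab]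
    have h1 := eVariationOn.edist_le φ (s := Icc a b) (x := b) (y := a)
      ⟨hab, le_rfl⟩ ⟨le_rfl, hab⟩
    have h2 : ‖φ b - φ a‖ ≤ (eVariationOn φ (Icc a b)).toReal := by
      rw [← dist_eq_norm, dist_edist]
      exact ENNReal.toReal_mono (hfin a b) h1
    have h3 := PiLp.norm_apply_le (φ b - φ a) i
    rw [PiLp.sub_apply] at h3
    exact (le_abs_self _).trans (h3.trans h2)
  let W : Fin d → StieltjesFunction ℝ := fun i =>
    { toFun := fun x => V x - φ x i
      mono' := fun a b hab => by
        have := hW i a b hab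
        show V a - φ a i ≤ V b - φ b i
        linarith
      right_continuous' := fun x => by
        have hci : Continuous (fun x => φ x i) := by fun_prop
        exact (V.right_continuous x).sub hci.continuousWithinAt }
  { pos := fun _ => V.measure
    neg := fun i => (W i).measure
    var := V.measure
    pos_fin := fun i t => measure_Icc_lt_top
    neg_fin := fun i t => measure_Icc_lt_top
    increments := fun i s t hs hst => by
      rw [StieltjesFunction.measure_Ioc, StieltjesFunction.measure_Ioc,
        ENNReal.toReal_ofReal (sub_nonneg.2 (V.mono hst)),
        ENNReal.toReal_ofReal (sub_nonneg.2 ((W i).mono hst))]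
      change V t - V s - ((V t - φ t i) - (V s - φ s i)) = _
      ring
    var_eq := fun s t hs hst => by
      rw [StieltjesFunction.measure_Ioc, hV s t hst, ENNReal.ofReal_toReal (hfin s t)] }

lemma mkData_var {d : ℕ} (φ : ℝ → Euc d) (hc : Continuous φ) (hbv : BoundedVariationOn φ univ)
    {s t : ℝ} (hst : s ≤ t) :
    (mkData φ hc hbv).var (Ioc s t) = eVariationOn φ (Icc s t) := by
  have h1 := variationOnFromTo.add hbv.locallyBoundedVariationOn
      (mem_univ (0 : ℝ)) (mem_univ s) (mem_univ t)
  have h2 := variationOnFromTo.eq_of_le φ univ hst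
  rw [univ_inter] at h2
  have hfin : eVariationOn φ (Icc s t) ≠ ⊤ :=
    ((eVariationOn.mono φ (subset_univ _)).trans_lt hbv.lt_top).ne
  simp only [mkData]
  rw [StieltjesFunction.measure_Ioc]
  change ENNReal.ofReal (variationOnFromTo φ univ 0 t - variationOnFromTo φ univ 0 s) = _
  rw [← h1, add_sub_cancel_left, h2, ENNReal.ofReal_toReal hfin]

/-- **Lemma 4.1.5.** Let `D ⊆ ℝ^d` be a nonempty convex open set and `T > 0`. Suppose that
for each `n` the Skorohod equation `Xₙ = wₙ + φₙ` has a solution on `[0, T]`, that `wₙ`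
converges uniformly on `[0, T]` to a continuous `w` with `w(0) ∈ closure D`, and that the
total variations `|φₙ|(T)` are bounded. Then `Xₙ` converges uniformly on `[0, T]` to some
`X`, and `(X, φ)` with `φ = X − w` is the solution of the Skorohod equation `X = w + φ`
on `[0, T]`. -/
theorem skorohod_solution_limit {d : ℕ} (D : Set (Euc d)) (hne : D.Nonempty)
    (hconv : Convex ℝ D) (hopen : IsOpen D) (T : ℝ) (hT : 0 < T)
    (w : ℕ → ℝ → Euc d) (X : ℕ → ℝ → Euc d) (φ : ℕ → ℝ → Euc d)
    (M : ∀ n : ℕ, BVMeasureData d (φ n))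
    (hw_rc : ∀ n, RightContinuousOnNonneg (w n)) (hw_ll : ∀ n, HasLeftLimitsOnPos (w n))
    (hw0 : ∀ n, w n 0 ∈ closure D)
    (hsol : ∀ n, IsSkorohodSolutionOn D (w n) (X n) (φ n) (M n) T)
    (wlim : ℝ → Euc d) (hwlim_cont : ContinuousOn wlim (Ici 0))
    (hwlim0 : wlim 0 ∈ closure D)
    (hw_unif : TendstoUniformlyOn w wlim atTop (Icc 0 T))
    (hvar_bdd : ∃ C : ENNReal, C < ⊤ ∧ ∀ n, eVariationOn (φ n) (Icc 0 T) ≤ C) :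
    ∃ Xlim : ℝ → Euc d,
      TendstoUniformlyOn X Xlim atTop (Icc 0 T) ∧
      ∃ Mlim : BVMeasureData d (fun t => Xlim t - wlim t),
        IsSkorohodSolutionOn D wlim Xlim (fun t => Xlim t - wlim t) Mlim T := by
  classical
  obtain ⟨C', hC'top, hC'⟩ := hvar_bdd
  obtain ⟨C, hC, hφ⟩ : ∃ C : ℝ, 0 ≤ C ∧
      ∀ n, eVariationOn (φ n) (Icc 0 T) ≤ ENNReal.ofReal C :=
    ⟨C'.toReal, ENNReal.toReal_nonneg, fun n => by
      rw [ENNReal.ofReal_toReal hC'top.ne]; exact hC' n⟩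
  have hsmall : ∀ ε : ℝ, 0 < ε → ∀ K : ℝ, 0 < K → ∃ δ : ℝ, 0 < δ ∧ K * (δ * C) < ε ^ 2 := by
    intro ε hε K hK
    refine ⟨ε ^ 2 / (K * (C + 1)), by positivity, ?_⟩
    have : K * (ε ^ 2 / (K * (C + 1)) * C) = ε ^ 2 * (C / (C + 1)) := by
      field_simp
    rw [this]
    have h1 : C / (C + 1) < 1 := by rw [div_lt_one (by positivity)]; linarith
    have h2 : 0 < ε ^ 2 := by positivity
    nlinarith
  rw [Metric.tendstoUniformlyOn_iff] at hw_unif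
  -- uniform Cauchy property
  have hcau : UniformCauchySeqOn φ atTop (Icc 0 T) := by
    rw [Metric.uniformCauchySeqOn_iff]
    intro ε hε
    obtain ⟨δ, hδ, hδ'⟩ := hsmall ε hε 4 (by norm_num)
    obtain ⟨N, hN⟩ := eventually_atTop.1 (hw_unif (δ / 2) (by positivity))
    refine ⟨N, fun m hm n hn t ht => ?_⟩
    have hb := compare_bound (hsol m) (hsol n) hC hδ.le (hφ m) (hφ n) (fun u hu => by
      have h1 := hN m hm u hu
      have h2 := hN n hn u hu
      rw [← dist_eq_norm]
      have := dist_triangle_left (w m u) (w n u) (wlim u)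
      linarith) ht
    rw [dist_eq_norm]
    exact lt_of_pow_lt_pow_left₀ 2 hε.le (hb.trans_lt hδ')
  have hpt : ∀ t, ∃ y, t ∈ Icc (0 : ℝ) T → Tendsto (fun n => φ n t) atTop (𝓝 y) := by
    intro t
    by_cases ht : t ∈ Icc (0 : ℝ) T
    · obtain ⟨y, hy⟩ := cauchySeq_tendsto_of_complete (hcau.cauchySeq ht)
      exact ⟨y, fun _ => hy⟩
    · exact ⟨0, fun h => absurd h ht⟩
  choose ψ hψ using hpt
  have hψu : TendstoUniformlyOn φ ψ atTop (Icc 0 T) :=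
    hcau.tendstoUniformlyOn_of_tendsto fun t ht => hψ t ht
  -- continuity of the limit
  have hinc : ∀ δ : ℝ, 0 < δ → ∀ s t : ℝ, 0 ≤ s → s ≤ t → t ≤ T →
      (∀ u ∈ Icc s t, ‖wlim u - wlim s‖ ≤ δ) → ‖ψ t - ψ s‖ ^ 2 ≤ 6 * (δ * C) := by
    intro δ hδ s t hs hst htT hu
    have hl : Tendsto (fun n => ‖φ n t - φ n s‖ ^ 2) atTop (𝓝 (‖ψ t - ψ s‖ ^ 2)) :=
      (((hψ t ⟨hs.trans hst, htT⟩).sub (hψ s ⟨hs, hst.trans htT⟩)).norm).pow 2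
    refine le_of_tendsto hl ?_
    filter_upwards [hw_unif δ hδ] with n hn
    have := increment_bound (hsol n) hC (δ := 3 * δ) (by positivity) (hφ n) hs hst htT
      (fun u huu => by
        have h1 := hn u ⟨hs.trans huu.1, huu.2.trans htT⟩
        have h2 := hn s ⟨hs, hst.trans htT⟩
        have h3 := hu u huu
        rw [← dist_eq_norm] at h3 ⊢
        have h4 := dist_triangle4_left (wlim u) (wlim s) (w n u) (w n s)
        linarith)
    linarith
  have hwc : ContinuousOn wlim (Icc 0 T) := hwlim_cont.mono Icc_subset_Ici_self
  have hψc : ContinuousOn ψ (Icc 0 T) := by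
    rw [Metric.continuousOn_iff]
    intro b hb ε hε
    obtain ⟨δ, hδ, hδ'⟩ := hsmall ε hε 6 (by norm_num)
    have huc := isCompact_Icc.uniformContinuousOn_of_continuous hwc
    rw [Metric.uniformContinuousOn_iff] at huc
    obtain ⟨ρ, hρ, hρ'⟩ := huc δ hδ
    refine ⟨ρ, hρ, fun a ha hab => ?_⟩
    rw [Real.dist_eq, abs_lt] at hab
    rw [dist_eq_norm]
    refine lt_of_pow_lt_pow_left₀ 2 hε.le (lt_of_le_of_lt ?_ hδ')
    rcases le_total a b with h | h
    · rw [norm_sub_rev]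
      refine hinc δ hδ a b ha.1 h hb.2 fun u hu => ?_
      rw [← dist_eq_norm]
      refine (hρ' u ⟨ha.1.trans hu.1, hu.2.trans hb.2⟩ a ha ?_).le
      rw [Real.dist_eq, abs_lt]; constructor <;> linarith [hu.1, hu.2, hab.1]
    · refine hinc δ hδ b a hb.1 h ha.2 fun u hu => ?_
      rw [← dist_eq_norm]
      refine (hρ' u ⟨hb.1.trans hu.1, hu.2.trans ha.2⟩ b hb ?_).le
      rw [Real.dist_eq, abs_lt]; constructor <;> linarith [hu.1, hu.2, hab.2]
  have hvψ : eVariationOn ψ (Icc 0 T) ≤ ENNReal.ofReal C := by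
    by_contra hcon
    obtain ⟨n, hn⟩ := (eVariationOn.lowerSemicontinuous_aux (F := φ) (p := atTop)
      (fun x hx => hψ x hx) (not_le.1 hcon)).exists
    exact absurd (hφ n) (not_le.2 hn)
  -- extension to the whole line
  obtain ⟨pr, hpr⟩ : ∃ pr : ℝ → ℝ, pr = fun t => max 0 (min T t) := ⟨_, rfl⟩
  have hpr_mem : ∀ t, pr t ∈ Icc (0 : ℝ) T := fun t => by
    rw [hpr]; exact ⟨le_max_left _ _, max_le hT.le (min_le_left _ _)⟩
  have hpr_id : ∀ t ∈ Icc (0 : ℝ) T, pr t = t := fun t ht => by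
    simp [hpr, ht.1, ht.2]
  have hpr_c : Continuous pr := by rw [hpr]; fun_prop
  have hpr_m : Monotone pr := by
    rw [hpr]; intro a b hab
    exact max_le_max le_rfl (min_le_min le_rfl hab)
  obtain ⟨Φ, hΦ⟩ : ∃ Φ : ℝ → Euc d, Φ = fun t => ψ (pr t) := ⟨_, rfl⟩
  have hΦψ : ∀ t ∈ Icc (0 : ℝ) T, Φ t = ψ t := fun t ht => by rw [hΦ]; simp only [hpr_id t ht]
  have hΦc : Continuous Φ := by
    rw [hΦ]; exact hψc.comp_continuous hpr_c hpr_mem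
  have hΦv : eVariationOn Φ univ ≤ ENNReal.ofReal C := by
    rw [hΦ]
    exact (eVariationOn.comp_le_of_monotoneOn ψ pr (hpr_m.monotoneOn univ)
      (fun t _ => hpr_mem t)).trans hvψ
  have hΦbv : BoundedVariationOn Φ univ := (hΦv.trans_lt ENNReal.ofReal_lt_top).ne
  have hXu : TendstoUniformlyOn X (fun t => wlim t + Φ t) atTop (Icc 0 T) := by
    rw [Metric.tendstoUniformlyOn_iff] at hψu ⊢
    intro ε hε
    filter_upwards [hw_unif (ε / 2) (by positivity), hψu (ε / 2) (by positivity)] with n h1 h2 t ht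
    rw [(hsol n).eqn t ht, hΦψ t ht]
    have := dist_add_add_le (wlim t) (ψ t) (w n t) (φ n t)
    linarith [h1 t ht, h2 t ht]
  have hXc : ContinuousOn (fun t => wlim t + Φ t) (Icc 0 T) := hwc.add hΦc.continuousOn
  refine ⟨fun t => wlim t + Φ t, hXu, ?_⟩
  have hfun : (fun t => (fun t => wlim t + Φ t) t - wlim t) = Φ := by
    funext t; simp
  rw [hfun]
  refine ⟨mkData Φ hΦc hΦbv, ?_⟩
  have hXt : ∀ t ∈ Icc (0 : ℝ) T, Tendsto (fun n => X n t) atTop (𝓝 (wlim t + Φ t)) :=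
    fun t ht => hXu.tendsto_at ht
  rw [Metric.tendstoUniformlyOn_iff] at hXu
  refine
    { rightCont := fun t ht => ?_
      leftLim := fun t ht => ?_
      mem := fun t ht => ?_
      eqn := fun t _ => rfl
      phi_rightCont := fun t _ => hΦc.continuousWithinAt
      phi_leftLim := fun t _ => ⟨Φ t, (hΦc.tendsto t).mono_left nhdsWithin_le_nhds⟩
      bv := (eVariationOn.mono Φ (subset_univ _)).trans_lt hΦbv.lt_top
      init := ?_
      carried := ?_
      normal := ?_ }
  · exact ((hwlim_cont t ht.1).mono (Ici_subset_Ici.2 ht.1)).add hΦc.continuousWithinAt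
  · refine ⟨wlim t + Φ t, ?_⟩
    have h1 : ContinuousAt wlim t := hwlim_cont.continuousAt (Ici_mem_nhds ht.1)
    exact (h1.add hΦc.continuousAt).tendsto.mono_left nhdsWithin_le_nhds
  · exact isClosed_closure.mem_of_tendsto (hXt t ht)
      (Eventually.of_forall fun n => (hsol n).mem t ht)
  · have h0 : (0 : ℝ) ∈ Icc (0 : ℝ) T := ⟨le_rfl, hT.le⟩
    rw [hΦψ 0 h0]
    refine tendsto_nhds_unique (hψ 0 h0) ?_
    simp only [(hsol _).init]
    exact tendsto_const_nhds
  · refine measure_null_of_locally_null _ fun t₀ ht₀ => ?_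
    obtain ⟨ht₀, hD⟩ := ht₀
    obtain ⟨r, hr, hball⟩ := Metric.isOpen_iff.1 hopen _ hD
    obtain ⟨δ, hδ, hδ'⟩ := Metric.continuousOn_iff.1 hXc t₀ ht₀ (r / 2) (by positivity)
    refine ⟨Ioc (t₀ - δ / 2) (t₀ + δ / 2), mem_nhdsWithin_of_mem_nhds
      (Ioc_mem_nhds (by linarith) (by linarith)), ?_⟩
    rw [mkData_var Φ hΦc hΦbv (by linarith)]
    refine eVariationOn.constant_on ?_
    -- eventually `φ n` is constant on the relevant part of `[0,T]`
    have hconst : ∀ a b : ℝ, a ∈ Icc (0 : ℝ) T → b ∈ Icc (0 : ℝ) T → a ≤ b → |a - t₀| < δ →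
        |b - t₀| < δ → ψ a = ψ b := by
      intro a b ha hb hab had hbd
      rw [abs_lt] at had hbd
      refine tendsto_nhds_unique_of_eventuallyEq (hψ a ha) (hψ b hb) ?_
      filter_upwards [hXu (r / 2) (by positivity)] with n hn
      have hz : (M n).var (Ioc a b) = 0 := by
        refine measure_mono_null ?_ (hsol n).carried
        intro u hu
        have huT : u ∈ Icc (0 : ℝ) T := ⟨ha.1.trans hu.1.le, hu.2.trans hb.2⟩
        refine ⟨huT, hball ?_⟩
        rw [Metric.mem_ball]
        have h1 := hn u huT
        have h2 := hδ' u huT (by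
          rw [Real.dist_eq, abs_lt]; constructor <;> linarith [hu.1, hu.2, had.1, hbd.2])
        have h3 := dist_triangle_left (X n u) (wlim t₀ + Φ t₀) (wlim u + Φ u)
        linarith
      rw [(M n).var_eq a b ha.1 hab] at hz
      have h1 := eVariationOn.edist_le (φ n) (s := Icc a b) (x := a) (y := b)
        ⟨le_rfl, hab⟩ ⟨hab, le_rfl⟩
      rw [hz] at h1
      exact edist_le_zero.1 h1
    have hprd : ∀ x ∈ Icc (t₀ - δ / 2) (t₀ + δ / 2), |pr x - t₀| < δ := by
      intro x hx
      have h1 : pr (t₀ - δ / 2) ≤ pr x := hpr_m hx.1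
      have h2 : pr x ≤ pr (t₀ + δ / 2) := hpr_m hx.2
      have h3 : t₀ - δ / 2 ≤ pr (t₀ - δ / 2) := by
        rw [hpr]; exact le_max_of_le_right (le_min (by linarith [ht₀.2]) le_rfl)
      have h4 : pr (t₀ + δ / 2) ≤ t₀ + δ / 2 := by
        rw [hpr]; exact max_le (by linarith [ht₀.1]) (min_le_right _ _)
      rw [abs_lt]; constructor <;> linarith
    rintro _ ⟨x, hx, rfl⟩ _ ⟨y, hy, rfl⟩
    rw [hΦ]
    rcases le_total (pr x) (pr y) with h | h
    · exact hconst _ _ (hpr_mem x) (hpr_mem y) h (hprd x hx) (hprd y hy)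
    · exact (hconst _ _ (hpr_mem y) (hpr_mem x) h (hprd y hy) (hprd x hx)).symm
  · intro η hη hηD s t hs hst htT
    have hfc : ContinuousOn (fun τ => η τ - (wlim τ + Φ τ)) (Icc 0 T) :=
      hη.continuousOn.sub hXc
    have hsubT : Icc s t ⊆ Icc 0 T := Icc_subset_Icc hs htT
    have hfR : Reg (fun τ => η τ - (wlim τ + Φ τ)) s t := Reg.of_continuousOn (hfc.mono hsubT)
    have hXR : Reg (fun τ => wlim τ + Φ τ) s t := Reg.of_continuousOn (hXc.mono hsubT)
    have hηR : Reg η s t := Reg.of_continuousOn hη.continuousOn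
    have hclaim : ∀ ε : ℝ, 0 < ε →
        -(2 * (ε * C)) ≤ (mkData Φ hΦc hΦbv).pairing (fun τ => η τ - (wlim τ + Φ τ)) s t := by
      intro ε hε
      have huc := isCompact_Icc.uniformContinuousOn_of_continuous hfc
      rw [Metric.uniformContinuousOn_iff] at huc
      obtain ⟨ρ, hρ, hρ'⟩ := huc ε hε
      refine ge_of_tendsto (RS_tendsto (mkData Φ hΦc hΦbv) hs hst hfR) ?_
      have hmesh : Tendsto (fun N : ℕ => (t - s) * (1 / ((N : ℝ) + 1))) atTop
          (𝓝 ((t - s) * 0)) :=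
        tendsto_const_nhds.mul tendsto_one_div_add_atTop_nhds_zero_nat
      rw [mul_zero] at hmesh
      filter_upwards [hmesh.eventually_lt_const hρ] with N hN
      rw [mul_one_div] at hN
      have hRSlim : Tendsto (fun n => RS (fun τ => η τ - (wlim τ + Φ τ)) (φ n) s t N) atTop
          (𝓝 (RS (fun τ => η τ - (wlim τ + Φ τ)) Φ s t N)) := by
        unfold RS
        refine tendsto_finsetSum _ fun k hk => ?_
        have hk' : k < N + 1 := Finset.mem_range.1 hk
        have hr := hsubT (gp_mem hst (N := N) (k := k + 1) (by omega))
        have hl := hsubT (gp_mem hst (N := N) (k := k) (by omega))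
        rw [hΦψ _ hr, hΦψ _ hl]
        exact tendsto_const_nhds.inner ((hψ _ hr).sub (hψ _ hl))
      refine ge_of_tendsto hRSlim ?_
      filter_upwards [hXu ε hε] with n hn
      have hv : eVariationOn (φ n) (Icc s t) ≤ ENNReal.ofReal C :=
        (eVariationOn.mono _ hsubT).trans (hφ n)
      have hXnR : Reg (X n) s t := (sol_regX (hsol n)).mono hs htT
      have h1 := (hsol n).normal η hη hηD s t hs hst htT
      have h2 := pairing_RS (M n) hs hst hfR hC hε.le hv N (fun k hk τ hτ => by
        have hr := gp_mem hst (N := N) (k := k + 1) (by omega)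
        have hl := gp_mem hst (N := N) (k := k) (by omega)
        rw [← dist_eq_norm]
        refine (hρ' τ (hsubT ⟨hl.1.trans hτ.1, hτ.2.trans hr.2⟩) _ (hsubT hr) ?_).le
        have := gp_step s t N k
        rw [Real.dist_eq, abs_lt]
        constructor <;> linarith [hτ.1, hτ.2])
      have h3 := pairing_le (M n) hs hst (hXR.sub hXnR) hC hε.le hv (fun τ hτ => by
        rw [← dist_eq_norm]; exact (hn τ (hsubT hτ)).le)
      rw [pairing_sub (M n) hs hst hXR hXnR] at h3
      rw [pairing_sub (M n) hs hst hηR hXnR] at h1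
      rw [pairing_sub (M n) hs hst hηR hXR] at h2
      linarith [(abs_le.1 h2).2, (abs_le.1 h3).2]
    have hl : Tendsto (fun n : ℕ => -(2 * (1 / ((n : ℝ) + 1) * C))) atTop
        (𝓝 (-(2 * (0 * C)))) :=
      ((tendsto_one_div_add_atTop_nhds_zero_nat.mul_const C).const_mul 2).neg
    simp only [zero_mul, mul_zero, neg_zero] at hl
    exact le_of_tendsto hl (Eventually.of_forall fun n => hclaim _ (by positivity))

end
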